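/- arXiv:1501.03624 — 5 statements merged into one kernel-verified Lean document; each statement's English description precedes it below -/
import Mathlib

section
/- For any constants H0, m, M, g, L, s0 > 0, the boundary value problem H0·s''(x) = (M + m·√(1 + s'(x)²))·g on [0,L] with s(0) = s(L) = s0 admits a unique twice continuously differentiable solution s : [0,L] → ℝ, and this solution is symmetric with respect to x = L/2, i.e. s(x) = s(L − x) for all x ∈ [0,L]. -/
open Set

/-- `s` is a twice continuously differentiable solution on `[0, L]` of the cable
boundary value problem `H0 * s'' = (M + m * √(1 + s'²)) * g`, `s 0 = s L = s0`. -/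
def IsCableBVPSol (H0 m M g L s0 : ℝ) (s : ℝ → ℝ) : Prop :=
  ContDiffOn ℝ 2 s (Icc 0 L) ∧
  (∀ x ∈ Icc 0 L,
    H0 * deriv (deriv s) x = (M + m * Real.sqrt (1 + (deriv s x) ^ 2)) * g) ∧
  s 0 = s0 ∧ s L = s0

/-- A scalar autonomous ODE `θ' = q θ` whose right-hand side is continuous, even, positive and
bounded has a global odd solution. -/
theorem exists_odd_hasDerivAt_autonomous {q : ℝ → ℝ} (hq : Continuous q)
    (hpos : ∀ x, 0 < q x) {C : ℝ} (hC : ∀ x, q x ≤ C) (heven : ∀ x, q (-x) = q x) :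
    ∃ θ : ℝ → ℝ, (∀ t, HasDerivAt θ (q (θ t)) t) ∧ ∀ t, θ (-t) = -θ t := by
  have hC0 : 0 < C := (hpos 0).trans_le (hC 0)
  have hqi : Continuous fun x => (q x)⁻¹ := hq.inv₀ fun x => (hpos x).ne'
  set T : ℝ → ℝ := fun y => ∫ x in (0 : ℝ)..y, (q x)⁻¹ with hT
  have hTd : ∀ y, HasDerivAt T (q y)⁻¹ y := fun y =>
    (hqi.integral_hasStrictDerivAt 0 y).hasDerivAt
  have hT0 : T 0 = 0 := by simp [hT]
  have hTodd : ∀ y, T (-y) = -T y := by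
    intro y
    have h := intervalIntegral.integral_comp_neg (a := 0) (b := y) fun x => (q x)⁻¹
    simp only [heven, neg_zero] at h
    simp only [hT]
    rw [h, intervalIntegral.integral_symm]
  have hmono : StrictMono T := strictMono_of_deriv_pos fun y => by
    rw [(hTd y).deriv]; exact inv_pos.2 (hpos y)
  have hgrow : ∀ ⦃x y⦄, x ≤ y → C⁻¹ * (y - x) ≤ T y - T x :=
    mul_sub_le_image_sub_of_le_deriv (fun y => (hTd y).differentiableAt) fun y => by
      rw [(hTd y).deriv]; exact inv_anti₀ (hpos y) (hC y)
  have htop : Filter.Tendsto T Filter.atTop Filter.atTop := by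
    refine Filter.tendsto_atTop_mono' _ ?_
      (Filter.tendsto_id.const_mul_atTop (inv_pos.2 hC0))
    filter_upwards [Filter.eventually_ge_atTop 0] with y hy
    simpa [hT0] using hgrow hy
  have hbot : Filter.Tendsto T Filter.atBot Filter.atBot := by
    refine Filter.tendsto_atBot_mono' _ ?_
      (Filter.tendsto_id.const_mul_atBot (inv_pos.2 hC0))
    filter_upwards [Filter.eventually_le_atBot 0] with y hy
    have := hgrow hy
    simp only [hT0, id] at this ⊢
    linarith
  have hsurj : Function.Surjective T :=
    Continuous.surjective (continuous_iff_continuousAt.2 fun y => (hTd y).continuousAt) htop hbot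
  set e := hmono.orderIsoOfSurjective T hsurj with he
  have hTe : ∀ t, T (e.symm t) = t := fun t => e.apply_symm_apply t
  refine ⟨e.symm, fun t => ?_, fun t => hmono.injective ?_⟩
  · simpa using HasDerivAt.of_local_left_inverse (f := T) (g := e.symm)
      e.symm.continuous.continuousAt (hTd _) (inv_pos.2 (hpos _)).ne' (.of_forall hTe)
  · rw [hTe, hTodd, hTe]

/-- The autonomous equation `u' = a + b √(1 + u²)` has a global odd solution. -/
theorem exists_odd_hasDerivAt_add_mul_sqrt {a b : ℝ} (ha : 0 < a) (hb : 0 < b) :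
    ∃ u : ℝ → ℝ, (∀ t, HasDerivAt u (a + b * √(1 + u t ^ 2)) t) ∧ ∀ t, u (-t) = -u t := by
  obtain ⟨θ, hθ, hodd⟩ := exists_odd_hasDerivAt_autonomous
    (q := fun x => a / Real.cosh x + b) (C := a + b)
    ((continuous_const.div Real.continuous_cosh fun x => (Real.cosh_pos x).ne').add
      continuous_const)
    (fun x => add_pos (div_pos ha (Real.cosh_pos x)) hb)
    (fun x => by gcongr; exact div_le_self ha.le (Real.one_le_cosh x))
    (fun x => by simp)
  refine ⟨fun t => Real.sinh (θ t), fun t => ?_, fun t => by simp [hodd]⟩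
  convert (hθ t).sinh using 1
  have hc := Real.cosh_pos (θ t)
  rw [← Real.cosh_sq', Real.sqrt_sq hc.le]
  field_simp

theorem lipschitzWith_sqrt_one_add_sq : LipschitzWith 1 fun x : ℝ => √(1 + x ^ 2) := by
  refine LipschitzWith.of_le_add fun x y => ?_
  rw [Real.dist_eq]
  refine Real.sqrt_le_iff.2 ⟨by positivity, ?_⟩
  have h1 : √(1 + y ^ 2) ^ 2 = 1 + y ^ 2 := Real.sq_sqrt (by positivity)
  have h2 : |y| ≤ √(1 + y ^ 2) := Real.abs_le_sqrt (by linarith)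
  have h3 : (x - y) * y ≤ |x - y| * √(1 + y ^ 2) :=
    (le_abs_self _).trans (by rw [abs_mul]; gcongr)
  nlinarith [sq_abs (x - y)]

namespace IsCableBVPSol

variable {H0 m M g L s0 : ℝ} {s s₁ s₂ : ℝ → ℝ}

theorem deriv_deriv_eq (hH0 : 0 < H0) (h : IsCableBVPSol H0 m M g L s0 s) {x : ℝ}
    (hx : x ∈ Icc 0 L) :
    deriv (deriv s) x = M * g / H0 + m * g / H0 * √(1 + deriv s x ^ 2) := by
  have := h.2.1 x hx
  field_simp
  linarith

theorem hasDerivAt_deriv (hH0 : 0 < H0) (hm : 0 < m) (hM : 0 < M) (hg : 0 < g)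
    (h : IsCableBVPSol H0 m M g L s0 s) {x : ℝ} (hx : x ∈ Icc 0 L) :
    HasDerivAt (deriv s) (M * g / H0 + m * g / H0 * √(1 + deriv s x ^ 2)) x := by
  rw [← h.deriv_deriv_eq hH0 hx]
  refine (differentiableAt_of_deriv_ne_zero ?_).hasDerivAt
  rw [h.deriv_deriv_eq hH0 hx]
  positivity

theorem differentiableAt (h : IsCableBVPSol H0 m M g L s0 s) {x : ℝ} (hx : x ∈ Ioo 0 L) :
    DifferentiableAt ℝ s x :=
  (h.1.contDiffAt (Icc_mem_nhds hx.1 hx.2)).differentiableAt (by norm_num)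

theorem eqOn (hH0 : 0 < H0) (hm : 0 < m) (hM : 0 < M) (hg : 0 < g) (hL : 0 < L)
    (h₁ : IsCableBVPSol H0 m M g L s0 s₁) (h₂ : IsCableBVPSol H0 m M g L s0 s₂) :
    EqOn s₁ s₂ (Icc 0 L) := by
  have hcont : ContinuousOn (fun x => s₁ x - s₂ x) (Icc 0 L) :=
    h₁.1.continuousOn.sub h₂.1.continuousOn
  have hderiv : ∀ x ∈ Ioo 0 L,
      HasDerivAt (fun x => s₁ x - s₂ x) (deriv s₁ x - deriv s₂ x) x := fun x hx =>
    (h₁.differentiableAt hx).hasDerivAt.sub (h₂.differentiableAt hx).hasDerivAt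
  obtain ⟨c, hc, hc0⟩ := exists_hasDerivAt_eq_zero hL hcont
    (by simp only [h₁.2.2.1, h₁.2.2.2, h₂.2.2.1, h₂.2.2.2]) hderiv
  obtain ⟨K, hK⟩ : ∃ K, LipschitzWith K
      fun u : ℝ => M * g / H0 + m * g / H0 * √(1 + u ^ 2) :=
    ⟨_, (LipschitzWith.const (M * g / H0)).add
      ((lipschitzWith_smul (m * g / H0)).comp lipschitzWith_sqrt_one_add_sq)⟩
  have heq : EqOn (deriv s₁) (deriv s₂) (Ioo 0 L) :=
    ODE_solution_unique_of_mem_Ioo (s := fun _ => univ)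
      (v := fun _ u => M * g / H0 + m * g / H0 * √(1 + u ^ 2))
      (fun _ _ => hK.lipschitzOnWith) hc
      (fun _ ht => ⟨h₁.hasDerivAt_deriv hH0 hm hM hg (Ioo_subset_Icc_self ht), mem_univ _⟩)
      (fun _ ht => ⟨h₂.hasDerivAt_deriv hH0 hm hM hg (Ioo_subset_Icc_self ht), mem_univ _⟩)
      (sub_eq_zero.1 hc0)
  intro x hx
  rcases hx.1.eq_or_lt with rfl | hx0
  · rw [h₁.2.2.1, h₂.2.2.1]
  obtain ⟨y, hy, hy'⟩ := exists_hasDerivAt_eq_slope (fun x => s₁ x - s₂ x) _ hx0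
    (hcont.mono (Icc_subset_Icc_right hx.2)) fun z hz => hderiv z ⟨hz.1, hz.2.trans_le hx.2⟩
  rw [heq ⟨hy.1, hy.2.trans_le hx.2⟩, sub_self, eq_comm, div_eq_zero_iff, h₁.2.2.1, h₂.2.2.1]
    at hy'
  rcases hy' with hy' | hy' <;> linarith

theorem comp_const_sub (h : IsCableBVPSol H0 m M g L s0 s) :
    IsCableBVPSol H0 m M g L s0 fun x => s (L - x) := by
  have hmaps : MapsTo (fun x => L - x) (Icc 0 L) (Icc 0 L) := fun x hx =>
    ⟨by linarith [hx.2], by linarith [hx.1]⟩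
  refine ⟨h.1.comp (contDiff_const.sub contDiff_id).contDiffOn hmaps, fun x hx => ?_,
    by simpa using h.2.2.2, by simpa using h.2.2.1⟩
  have hd : deriv (fun x => s (L - x)) = fun x => -deriv s (L - x) :=
    funext fun y => deriv_comp_const_sub s L y
  rw [hd, deriv.fun_neg, deriv_comp_const_sub]
  simpa using h.2.1 (L - x) (hmaps hx)

end IsCableBVPSol

theorem exists_isCableBVPSol {H0 m M g : ℝ} (hH0 : 0 < H0) (hm : 0 < m) (hM : 0 < M)
    (hg : 0 < g) (L s0 : ℝ) : ∃ s : ℝ → ℝ, IsCableBVPSol H0 m M g L s0 s := by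
  obtain ⟨u, hu, hodd⟩ := exists_odd_hasDerivAt_add_mul_sqrt
    (a := M * g / H0) (b := m * g / H0) (by positivity) (by positivity)
  have huc : Continuous u := continuous_iff_continuousAt.2 fun t => (hu t).continuousAt
  set S : ℝ → ℝ := fun y => ∫ x in (0 : ℝ)..y, u x with hS
  have hSd : ∀ y, HasDerivAt S (u y) y := fun y =>
    (huc.integral_hasStrictDerivAt 0 y).hasDerivAt
  have hSeven : ∀ y, S (-y) = S y := by
    intro y
    have h := intervalIntegral.integral_comp_neg (a := 0) (b := y) u
    simp only [hodd, neg_zero, intervalIntegral.integral_neg] at h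
    simp only [hS]
    rw [intervalIntegral.integral_symm, ← h, neg_neg]
  have hs : ∀ x, HasDerivAt (fun x => s0 - S (L / 2) + S (x - L / 2)) (u (x - L / 2)) x :=
    fun x => ((hSd _).comp_sub_const x (L / 2)).const_add _
  have hd : deriv (fun x => s0 - S (L / 2) + S (x - L / 2)) = fun x => u (x - L / 2) :=
    funext fun x => (hs x).deriv
  have hd2 : ∀ x, HasDerivAt (fun x => u (x - L / 2))
      (M * g / H0 + m * g / H0 * √(1 + u (x - L / 2) ^ 2)) x :=
    fun x => (hu _).comp_sub_const x (L / 2)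
  refine ⟨fun x => s0 - S (L / 2) + S (x - L / 2), ContDiff.contDiffOn ?_, fun x _ => ?_, ?_, ?_⟩
  · rw [show (2 : WithTop ℕ∞) = 1 + 1 by norm_num, contDiff_succ_iff_deriv, hd,
      contDiff_one_iff_deriv, funext fun x => (hd2 x).deriv]
    exact ⟨fun x => (hs x).differentiableAt, by simp, fun x => (hd2 x).differentiableAt,
      by fun_prop⟩
  · rw [hd, (hd2 x).deriv]
    field_simp
  · simp [hSeven]
  · simp [show L - L / 2 = L / 2 by ring]

theorem cable_bvp_exists_unique_symmetric
    (H0 m M g L s0 : ℝ)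
    (hH0 : 0 < H0) (hm : 0 < m) (hM : 0 < M) (hg : 0 < g) (hL : 0 < L) (hs0 : 0 < s0) :
    (∃ s : ℝ → ℝ, IsCableBVPSol H0 m M g L s0 s) ∧
    (∀ s₁ s₂ : ℝ → ℝ, IsCableBVPSol H0 m M g L s0 s₁ → IsCableBVPSol H0 m M g L s0 s₂ →
      ∀ x ∈ Icc 0 L, s₁ x = s₂ x) ∧
    (∀ s : ℝ → ℝ, IsCableBVPSol H0 m M g L s0 s → ∀ x ∈ Icc 0 L, s x = s (L - x)) := by
  refine ⟨exists_isCableBVPSol hH0 hm hM hg L s0, fun s₁ s₂ h₁ h₂ x hx => ?_,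
    fun s h x hx => ?_⟩
  · exact h₁.eqOn hH0 hm hM hg hL h₂ hx
  · exact h.eqOn hH0 hm hM hg hL h.comp_const_sub hx
end

section
/- For any constants H0, m, M, g, L > 0 and any s1 ∈ ℝ, the initial value problem H0·s''(x) = (M + m·√(1 + s'(x)²))·g with s(L/2) = s1 and s'(L/2) = 0 has a unique twice continuously differentiable solution defined on the whole real line. -/
/-- A primitive of a continuous function with values in `[ε, ∞)`, `ε > 0`, is a strictly monotone
surjection of the line. -/
theorem strictMono_surjective_of_hasDerivAt_of_le {f f' : ℝ → ℝ} {ε : ℝ} (hε : 0 < ε)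
    (hf : ∀ x, HasDerivAt f (f' x) x) (hle : ∀ x, ε ≤ f' x) :
    StrictMono f ∧ Function.Surjective f := by
  have hcont : Continuous f := continuous_iff_continuousAt.2 fun x => (hf x).continuousAt
  have hmono : Monotone fun x => f x - ε * x := by
    have hd (x : ℝ) : HasDerivAt (fun x => f x - ε * x) (f' x - ε * 1) x :=
      (hf x).sub ((hasDerivAt_id x).const_mul ε)
    refine monotone_of_deriv_nonneg (fun x => (hd x).differentiableAt) fun x => ?_
    rw [(hd x).deriv]
    linarith [hle x]
  refine ⟨strictMono_of_deriv_pos fun x => ?_, hcont.surjective ?_ ?_⟩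
  · rw [(hf x).deriv]
    exact hε.trans_le (hle x)
  · refine Filter.tendsto_atTop_mono' _ ?_
      (Filter.tendsto_atTop_add_const_left _ (f 0) (Filter.tendsto_id.const_mul_atTop hε))
    filter_upwards [Filter.eventually_ge_atTop 0] with x hx
    have := hmono hx
    simp only [id] at *
    linarith
  · refine Filter.tendsto_atBot_mono' _ ?_
      (Filter.tendsto_atBot_add_const_left _ (f 0) (Filter.tendsto_id.const_mul_atBot hε))
    filter_upwards [Filter.eventually_le_atBot 0] with x hx
    have := hmono hx
    simp only [id] at *
    linarith

/-- Every continuous function on the line has a primitive with prescribed value at a point. -/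
theorem Continuous.exists_primitive {f : ℝ → ℝ} (hf : Continuous f) (x₀ y₀ : ℝ) :
    ∃ F : ℝ → ℝ, F x₀ = y₀ ∧ ∀ x, HasDerivAt F (f x) x :=
  ⟨fun x => y₀ + ∫ t in x₀..x, f t, by simp, fun x =>
    (intervalIntegral.integral_hasDerivAt_right (hf.intervalIntegrable _ _)
      (hf.stronglyMeasurableAtFilter _ _) hf.continuousAt).const_add y₀⟩

/-- Two differentiable functions with the same derivative and a common value are equal. -/
theorem eq_of_hasDerivAt_of_apply_eq {f g f' : ℝ → ℝ} {x₀ : ℝ} (hf : ∀ x, HasDerivAt f (f' x) x)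
    (hg : ∀ x, HasDerivAt g (f' x) x) (h₀ : f x₀ = g x₀) : f = g := by
  funext x
  have hd (x : ℝ) : HasDerivAt (f - g) 0 x := by
    simpa using (hf x).sub (hg x)
  have := is_const_of_deriv_eq_zero (fun x => (hd x).differentiableAt) (fun x => (hd x).deriv) x x₀
  simp only [Pi.sub_apply] at this
  linarith

/-- An autonomous scalar equation `θ' = F θ` with `F` continuous, positive and bounded has exactly
one global solution with given initial value, by separation of variables. -/
theorem existsUnique_autonomous {F : ℝ → ℝ} {C : ℝ} (hF : Continuous F) (hpos : ∀ y, 0 < F y)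
    (hC : ∀ y, F y ≤ C) (x₀ y₀ : ℝ) :
    ∃! θ : ℝ → ℝ, (∀ x, HasDerivAt θ (F (θ x)) x) ∧ θ x₀ = y₀ := by
  obtain ⟨φ, hφ₀, hφ⟩ :=
    (hF.inv₀ fun y => (hpos y).ne').exists_primitive y₀ x₀
  obtain ⟨hmono, hsurj⟩ := strictMono_surjective_of_hasDerivAt_of_le
    (inv_pos.2 ((hpos 0).trans_le (hC 0))) hφ fun y => inv_anti₀ (hpos y) (hC y)
  let e := hmono.orderIsoOfSurjective φ hsurj
  have he (x : ℝ) : φ (e.symm x) = x := e.apply_symm_apply x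
  refine ⟨e.symm, ⟨fun x => ?_, hmono.injective ((he x₀).trans hφ₀.symm)⟩, fun θ hθ => ?_⟩
  · have := (hφ (e.symm x)).of_local_left_inverse e.symm.continuous.continuousAt
      (inv_ne_zero (hpos _).ne') (Filter.Eventually.of_forall he)
    rwa [Pi.inv_apply, inv_inv] at this
  · have hcomp : φ ∘ θ = id := by
      refine eq_of_hasDerivAt_of_apply_eq (f' := fun _ => 1) (x₀ := x₀) (fun x => ?_)
        hasDerivAt_id (by simp [hθ.2, hφ₀])
      have := (hφ (θ x)).comp x (hθ.1 x)
      rwa [Pi.inv_apply, inv_mul_cancel₀ (hpos _).ne'] at this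
    funext x
    exact hmono.injective ((congrFun hcomp x).trans (he x).symm)

/-- The equation `u' = a + b √(1 + u²)` with `a, b > 0` has exactly one global solution with given
initial value. -/
theorem existsUnique_hasDerivAt_add_mul_sqrt {a b : ℝ} (ha : 0 < a) (hb : 0 < b) (x₀ y₀ : ℝ) :
    ∃! u : ℝ → ℝ, (∀ x, HasDerivAt u (a + b * √(1 + u x ^ 2)) x) ∧ u x₀ = y₀ := by
  have hF : Continuous fun y => a / Real.cosh y + b :=
    (continuous_const.div Real.continuous_cosh fun y => (Real.cosh_pos y).ne').add continuous_const
  obtain ⟨θ, ⟨hθ, hθ₀⟩, huniq⟩ := existsUnique_autonomous hF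
    (fun y => add_pos (div_pos ha (Real.cosh_pos y)) hb)
    (C := a + b) (fun y => by gcongr; exact div_le_self ha.le (Real.one_le_cosh y))
    x₀ (Real.arsinh y₀)
  refine ⟨fun x => Real.sinh (θ x), ⟨fun x => ?_, by simp [hθ₀]⟩, fun u hu => ?_⟩
  · convert (hθ x).sinh using 1
    have := Real.cosh_pos (θ x)
    rw [add_comm 1, ← Real.cosh_sq, Real.sqrt_sq this.le]
    field_simp
  · rw [← huniq (fun x => Real.arsinh (u x)) ⟨fun x => ?_, by simp [hu.2]⟩]
    · simp
    · convert (hu.1 x).arsinh using 1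
      have : 0 < √(1 + u x ^ 2) := by positivity
      rw [Real.cosh_arsinh, smul_eq_mul]
      field_simp

theorem cable_ivp_exists_unique
    (H0 m M g L : ℝ) (s1 : ℝ)
    (hH0 : 0 < H0) (hm : 0 < m) (hM : 0 < M) (hg : 0 < g) (hL : 0 < L) :
    ∃! s : ℝ → ℝ, ContDiff ℝ 2 s ∧
      (∀ x : ℝ,
        H0 * deriv (deriv s) x = (M + m * Real.sqrt (1 + (deriv s x) ^ 2)) * g) ∧
      s (L / 2) = s1 ∧ deriv s (L / 2) = 0 := by
  obtain ⟨u, ⟨hu, hu₀⟩, huniq⟩ := existsUnique_hasDerivAt_add_mul_sqrt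
    (div_pos (mul_pos hM hg) hH0) (div_pos (mul_pos hm hg) hH0) (L / 2) 0
  have hucont : Continuous u := continuous_iff_continuousAt.2 fun x => (hu x).continuousAt
  obtain ⟨s, hs₀, hs⟩ := hucont.exists_primitive (L / 2) s1
  have hderiv : deriv s = u := funext fun x => (hs x).deriv
  have hderiv₂ : deriv u = fun x => M * g / H0 + m * g / H0 * √(1 + u x ^ 2) :=
    funext fun x => (hu x).deriv
  refine ⟨s, ⟨?_, fun x => ?_, hs₀, by rw [hderiv, hu₀]⟩, fun r hr => ?_⟩
  · have hu1 : ContDiff ℝ 1 u := by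
      rw [contDiff_one_iff_deriv, hderiv₂]
      exact ⟨fun x => (hu x).differentiableAt, by fun_prop⟩
    rw [← one_add_one_eq_two, contDiff_succ_iff_deriv, hderiv]
    exact ⟨fun x => (hs x).differentiableAt, by simp, hu1⟩
  · rw [hderiv, hderiv₂]
    field_simp
  · obtain ⟨hr, hode, hr₀, hr₁⟩ := hr
    have hr' : ContDiff ℝ 1 (deriv r) := by
      rw [← one_add_one_eq_two, contDiff_succ_iff_deriv] at hr
      exact hr.2.2
    have hru : deriv r = u := by
      refine huniq _ ⟨fun x => ?_, hr₁⟩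
      refine (hr'.differentiable one_ne_zero x).hasDerivAt.congr_deriv ?_
      rw [← mul_right_inj' hH0.ne', hode x]
      field_simp
    refine eq_of_hasDerivAt_of_apply_eq (fun x => ?_) hs (hr₀.trans hs₀.symm)
    rw [← hru]
    exact (hr.differentiable two_ne_zero x).hasDerivAt
end

section
/- For any constants H0, m, M, g > 0 and any x0 ∈ ℝ, if s : ℝ → ℝ is a twice continuously differentiable function satisfying H0·s''(x) = (M + m·√(1 + s'(x)²))·g on ℝ with s'(x0) = 0, then the reflected function x ↦ s(2·x0 − x) satisfies the same ODE on ℝ with the same value and derivative at x0; consequently s(x) = s(2·x0 − x) for all x ∈ ℝ. -/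
theorem abs_sqrt_one_add_sq_sub_le (a b : ℝ) :
    |Real.sqrt (1 + a ^ 2) - Real.sqrt (1 + b ^ 2)| ≤ |a - b| := by
  have ha := Real.sq_sqrt (show (0 : ℝ) ≤ 1 + a ^ 2 by positivity)
  have hb := Real.sq_sqrt (show (0 : ℝ) ≤ 1 + b ^ 2 by positivity)
  have key : 1 + a * b ≤ Real.sqrt (1 + a ^ 2) * Real.sqrt (1 + b ^ 2) := by
    rw [← Real.sqrt_mul (by positivity)]
    apply Real.le_sqrt_of_sq_le
    nlinarith [sq_nonneg (a - b)]
  apply sq_le_sq.mp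
  nlinarith

theorem lipschitzWith_cable_slope_field (c d : ℝ) :
    LipschitzWith ‖d‖₊ (fun p : ℝ => c + d * Real.sqrt (1 + p ^ 2)) := by
  apply LipschitzWith.of_dist_le_mul
  intro a b
  rw [Real.dist_eq, Real.dist_eq, add_sub_add_left_eq_sub, ← mul_sub, abs_mul, coe_nnnorm,
    Real.norm_eq_abs]
  exact mul_le_mul_of_nonneg_left (abs_sqrt_one_add_sq_sub_le a b) (abs_nonneg d)

/-- A solution of an autonomous equation `p' = F p` with `F` even and Lipschitz which vanishes
at `x0` is odd about `x0`. -/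
theorem odd_about_of_hasDerivAt_even {F p : ℝ → ℝ} {K : NNReal} {x0 : ℝ}
    (hF : LipschitzWith K F) (heven : ∀ y, F (-y) = F y)
    (hp : ∀ x, HasDerivAt p (F (p x)) x) (h0 : p x0 = 0) (x : ℝ) :
    p x = -p (2 * x0 - x) := by
  have h : p = fun x => -p (2 * x0 - x) := by
    refine ODE_solution_unique_univ (v := fun _ => F) (s := fun _ => Set.univ) (K := K) (t₀ := x0)
      (fun _ => hF.lipschitzOnWith) (fun t => ⟨hp t, trivial⟩) (fun t => ⟨?_, trivial⟩) ?_
    · simpa [heven] using ((hp (2 * x0 - t)).comp_const_sub (2 * x0) t).fun_neg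
    · simp [two_mul, h0]
  exact congrFun h x

theorem cable_reflection
    (H0 m M g : ℝ) (x0 : ℝ)
    (hH0 : 0 < H0) (hm : 0 < m) (hM : 0 < M) (hg : 0 < g)
    (s : ℝ → ℝ)
    (hs : ContDiff ℝ 2 s)
    (hode : ∀ x : ℝ,
      H0 * deriv (deriv s) x = (M + m * Real.sqrt (1 + (deriv s x) ^ 2)) * g)
    (hd : deriv s x0 = 0) :
    ContDiff ℝ 2 (fun x => s (2 * x0 - x)) ∧
    (∀ x : ℝ,
      H0 * deriv (deriv (fun x => s (2 * x0 - x))) x =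
        (M + m * Real.sqrt (1 + (deriv (fun x => s (2 * x0 - x)) x) ^ 2)) * g) ∧
    s (2 * x0 - x0) = s x0 ∧
    deriv (fun x => s (2 * x0 - x)) x0 = deriv s x0 ∧
    (∀ x : ℝ, s x = s (2 * x0 - x)) := by
  have hx0 : 2 * x0 - x0 = x0 := by ring
  have hs1 : Differentiable ℝ s := hs.differentiable (by norm_num)
  have hs2 : Differentiable ℝ (deriv s) := hs.differentiable_deriv_two
  have hder : deriv (fun x => s (2 * x0 - x)) = fun x => -deriv s (2 * x0 - x) :=
    funext fun x => deriv_comp_const_sub s (2 * x0) x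
  have hodd : ∀ x, deriv s x = -deriv s (2 * x0 - x) := by
    refine odd_about_of_hasDerivAt_even
      (lipschitzWith_cable_slope_field (M * g / H0) (m * g / H0)) (fun y => by simp)
      (fun x => ?_) hd
    have hval : deriv (deriv s) x =
        M * g / H0 + m * g / H0 * Real.sqrt (1 + deriv s x ^ 2) := by
      rw [eq_div_of_mul_eq hH0.ne' ((mul_comm _ _).trans (hode x))]
      ring
    exact hval ▸ (hs2 x).hasDerivAt
  have hsymm : ∀ x, s x = s (2 * x0 - x) := by
    have hdiff : Differentiable ℝ (fun x => s (2 * x0 - x)) := by fun_prop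
    have hconst := is_const_of_deriv_eq_zero (hs1.sub hdiff) (fun x => by
      rw [deriv_sub (hs1 x) (hdiff x), hder, hodd x]
      ring)
    intro x
    have := hconst x x0
    simp only [Pi.sub_apply, hx0, sub_self] at this
    linarith
  have heq : (fun x => s (2 * x0 - x)) = s := funext fun x => (hsymm x).symm
  rw [heq]
  exact ⟨hs, hode, by rw [hx0], rfl, hsymm⟩
end

section
/- Let f : [0,∞) → ℝ be continuously differentiable with f(0) = 0 and suppose there exist constants C1, C2 > 0 such that 0 ≤ f'(t) ≤ C1 + C2·√(f(t)) for all t ≥ 0. Then f(t) ≤ ((C1 + C2)²/4)·t² + (C1 + C2)·t for all t ≥ 0. -/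
open Set

theorem gronwall_type_lemma
    (f : ℝ → ℝ) (C1 C2 : ℝ) (hC1 : 0 < C1) (hC2 : 0 < C2)
    (hf : ContDiffOn ℝ 1 f (Ici 0))
    (hf0 : f 0 = 0)
    (hf' : ∀ t : ℝ, 0 ≤ t → 0 ≤ deriv f t ∧ deriv f t ≤ C1 + C2 * Real.sqrt (f t)) :
    ∀ t : ℝ, 0 ≤ t → f t ≤ (C1 + C2) ^ 2 / 4 * t ^ 2 + (C1 + C2) * t := by
  have hdiff : ∀ t : ℝ, 0 < t → DifferentiableAt ℝ f t := fun t ht ↦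
    (hf.differentiableOn one_ne_zero).differentiableAt (Ici_mem_nhds ht)
  have hmono : MonotoneOn f (Ici 0) := by
    refine monotoneOn_of_deriv_nonneg (convex_Ici 0) hf.continuousOn ?_ ?_ <;>
      rw [interior_Ici]
    · exact fun t ht ↦ (hdiff t ht).differentiableWithinAt
    · exact fun t ht ↦ (hf' t (le_of_lt ht)).1
  have hnonneg : ∀ t : ℝ, 0 ≤ t → 0 ≤ f t := fun t ht ↦
    hf0 ▸ hmono self_mem_Ici ht ht
  -- The function `√(f + 1)` grows at rate at most `(C1 + C2) / 2`.
  have hderiv : ∀ t : ℝ, 0 < t →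
      HasDerivAt (fun s ↦ √(f s + 1)) (deriv f t / (2 * √(f t + 1))) t := fun t ht ↦
    ((hdiff t ht).hasDerivAt.add_const 1).sqrt (by linarith [hnonneg t ht.le])
  intro t ht
  have hgrowth : √(f t + 1) - √(f 0 + 1) ≤ (C1 + C2) / 2 * (t - 0) := by
    refine (convex_Ici (0 : ℝ)).image_sub_le_mul_sub_of_deriv_le
      (f := fun s ↦ √(f s + 1)) (hf.continuousOn.add continuousOn_const).sqrt ?_ ?_
      0 self_mem_Ici t ht ht <;> rw [interior_Ici]
    · exact fun s hs ↦ (hderiv s hs).differentiableAt.differentiableWithinAt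
    · intro s hs
      have hs0 : 0 ≤ f s := hnonneg s (le_of_lt hs)
      have hone : 1 ≤ √(f s + 1) := Real.one_le_sqrt.mpr (by linarith)
      have hle : √(f s) ≤ √(f s + 1) := Real.sqrt_le_sqrt (by linarith)
      rw [(hderiv s hs).deriv, div_le_iff₀ (by linarith)]
      nlinarith [(hf' s (le_of_lt hs)).2, mul_le_mul_of_nonneg_left hone hC1.le,
        mul_le_mul_of_nonneg_left hle hC2.le]
  rw [hf0, zero_add, Real.sqrt_one, sub_zero] at hgrowth
  have hsq : f t + 1 ≤ (1 + (C1 + C2) / 2 * t) ^ 2 :=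
    Real.sqrt_le_iff.mp (by linarith) |>.2
  linarith
end

section
/- Let L > 0, s0 ∈ ℝ, and set a = 2/(3L). Define the parabola s_p(x) = s0 − a·x·(L − x) and the catenary s_c(x) = (1/(2a))·[cosh(a·(2x − L)) − cosh(a·L)] + s0 on [0,L]. Then 0 < s_p(x) − s_c(x) ≤ s_p(L/2) − s_c(L/2) for all x ∈ (0,L). -/
open Set

/-- Parabolic cable profile with load parameter `a = 2/(3L)`. -/
noncomputable def parabolaProfile (L s0 : ℝ) (x : ℝ) : ℝ :=
  s0 - (2 / (3 * L)) * x * (L - x)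

/-- Catenary cable profile with load parameter `a = 2/(3L)`. -/
noncomputable def catenaryProfile (L s0 : ℝ) (x : ℝ) : ℝ :=
  (1 / (2 * (2 / (3 * L)))) *
    (Real.cosh ((2 / (3 * L)) * (2 * x - L)) - Real.cosh ((2 / (3 * L)) * L)) + s0

theorem sq_sub_sq_div_two_lt_cosh_sub_cosh {u v : ℝ} (h : |u| < v) :
    (v ^ 2 - u ^ 2) / 2 < Real.cosh v - Real.cosh u := by
  obtain ⟨h₁, h₂⟩ := abs_lt.mp h
  have hp : 0 < (v + u) / 2 := by linarith
  have hq : 0 < (v - u) / 2 := by linarith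
  have key : Real.cosh v - Real.cosh u =
      2 * (Real.sinh ((v + u) / 2) * Real.sinh ((v - u) / 2)) := by
    have e₁ := Real.cosh_add ((v + u) / 2) ((v - u) / 2)
    have e₂ := Real.cosh_sub ((v + u) / 2) ((v - u) / 2)
    rw [show (v + u) / 2 + (v - u) / 2 = v by ring] at e₁
    rw [show (v + u) / 2 - (v - u) / 2 = u by ring] at e₂
    linarith
  have hmul := mul_lt_mul'' (Real.self_lt_sinh_iff.mpr hp) (Real.self_lt_sinh_iff.mpr hq)
    hp.le hq.le
  rw [key]
  linarith

theorem one_add_sq_div_two_le_cosh (u : ℝ) : 1 + u ^ 2 / 2 ≤ Real.cosh u := by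
  rcases eq_or_ne u 0 with rfl | hu
  · simp
  · have h := sq_sub_sq_div_two_lt_cosh_sub_cosh (u := 0) (v := |u|) (by simpa using hu)
    rw [Real.cosh_abs, Real.cosh_zero, sq_abs] at h
    linarith

theorem parabolaProfile_sub_catenaryProfile {L : ℝ} (hL : 0 < L) (s0 x : ℝ) :
    parabolaProfile L s0 x - catenaryProfile L s0 x =
      3 * L / 4 * (Real.cosh (2 / 3) - Real.cosh (2 / (3 * L) * (2 * x - L)) -
        ((2 / 3) ^ 2 - (2 / (3 * L) * (2 * x - L)) ^ 2) / 2) := by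
  have h : 2 / (3 * L) * L = 2 / 3 := by field_simp
  unfold parabolaProfile catenaryProfile
  rw [h]
  field_simp
  ring

theorem parabola_catenary_gap
    (L s0 : ℝ) (hL : 0 < L) :
    ∀ x ∈ Ioo 0 L,
      0 < parabolaProfile L s0 x - catenaryProfile L s0 x ∧
      parabolaProfile L s0 x - catenaryProfile L s0 x ≤
        parabolaProfile L s0 (L / 2) - catenaryProfile L s0 (L / 2) := by
  rintro x ⟨hx₀, hxL⟩
  rw [parabolaProfile_sub_catenaryProfile hL, parabolaProfile_sub_catenaryProfile hL]
  have hmid : 2 / (3 * L) * (2 * (L / 2) - L) = 0 := by ring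
  have hu : |2 / (3 * L) * (2 * x - L)| < 2 / 3 := by
    have ha : 0 < 2 / (3 * L) := by positivity
    rw [abs_mul, abs_of_pos ha]
    calc 2 / (3 * L) * |2 * x - L| < 2 / (3 * L) * L :=
          mul_lt_mul_of_pos_left (abs_lt.mpr ⟨by linarith, by linarith⟩) ha
      _ = 2 / 3 := by field_simp
  rw [hmid, Real.cosh_zero]
  constructor
  · exact mul_pos (by positivity) (by linarith [sq_sub_sq_div_two_lt_cosh_sub_cosh hu])
  · refine mul_le_mul_of_nonneg_left ?_ (by positivity)
    linarith [one_add_sq_div_two_le_cosh (2 / (3 * L) * (2 * x - L))]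
end
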